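/- arXiv:1709.02182 — 2 statements merged into one kernel-verified Lean document; each statement's English description precedes it below -/
import Mathlib

section
/- Let $a<b$, $k>0$, $\epsilon>0$ with $\sin(\sqrt{k/\epsilon}\,(b-a))\neq 0$, let $f:[a,b]\to\mathbb{R}$ be continuously differentiable, and let $t_0\in[a,b]$. Then the function $y_\epsilon(t)=\dfrac{\cos[\sqrt{k/\epsilon}(t-a)]\int_a^b\cos[\sqrt{k/\epsilon}(b-s)]\,\frac{f(s)}{\epsilon}\,ds}{\sqrt{k/\epsilon}\,\sin[\sqrt{k/\epsilon}(b-a)]}+\int_a^t\dfrac{\sin[\sqrt{k/\epsilon}(t-s)]\,\frac{f(s)}{\epsilon}}{\sqrt{k/\epsilon}}\,ds$ satisfies the representation $y_\epsilon(t_0)=\dfrac{f(t_0)}{k}+\dfrac{\cos[\sqrt{k/\epsilon}(t_0-a)]}{\sin[\sqrt{k/\epsilon}(b-a)]}\int_a^b\sin[\sqrt{k/\epsilon}(b-s)]\,\dfrac{f'(s)}{k}\,ds-\int_a^{t_0}\cos[\sqrt{k/\epsilon}(t_0-s)]\,\dfrac{f'(s)}{k}\,ds$. -/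
open Real Set

/-- The explicit solution formula
`y_ε(t) = cos(√(k/ε)(t-a)) ∫_a^b cos(√(k/ε)(b-s)) f(s)/ε ds / (√(k/ε) sin(√(k/ε)(b-a)))
          + ∫_a^t sin(√(k/ε)(t-s)) (f(s)/ε) / √(k/ε) ds`. -/
noncomputable def yFormula (a b k ε : ℝ) (f : ℝ → ℝ) (t : ℝ) : ℝ :=
  Real.cos (Real.sqrt (k / ε) * (t - a)) *
      (∫ s in a..b, Real.cos (Real.sqrt (k / ε) * (b - s)) * (f s / ε)) /
    (Real.sqrt (k / ε) * Real.sin (Real.sqrt (k / ε) * (b - a))) +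
  ∫ s in a..t, Real.sin (Real.sqrt (k / ε) * (t - s)) * (f s / ε) / Real.sqrt (k / ε)

lemma aux_parts (w a c : ℝ) (f f' : ℝ → ℝ) (hac : a ≤ c)
    (hf : ∀ t ∈ Icc a c, HasDerivWithinAt f (f' t) (Icc a c) t)
    (hf' : ContinuousOn f' (Icc a c)) :
    (∫ s in a..c, Real.sin (w * (c - s)) * f' s) =
        - (Real.sin (w * (c - a)) * f a) + w * ∫ s in a..c, Real.cos (w * (c - s)) * f s ∧
    (∫ s in a..c, Real.cos (w * (c - s)) * f' s) =
        f c - Real.cos (w * (c - a)) * f a - w * ∫ s in a..c, Real.sin (w * (c - s)) * f s := by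
  rw [← uIcc_of_le hac] at hf hf'
  have hlin : ∀ x : ℝ, HasDerivAt (fun s : ℝ => w * (c - s)) (-w) x := fun x => by
    simpa using ((hasDerivAt_id x).const_sub c).const_mul w
  constructor
  · rw [intervalIntegral.integral_mul_deriv_eq_deriv_mul_of_hasDerivWithinAt
      (u' := fun s => Real.cos (w * (c - s)) * (-w))
      (fun x _ => (hlin x).sin.hasDerivWithinAt) hf
      (Continuous.intervalIntegrable (by fun_prop) _ _) hf'.intervalIntegrable]
    have : ∀ s, Real.cos (w * (c - s)) * (-w) * f s = (-w) * (Real.cos (w * (c - s)) * f s) :=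
      fun s => by ring
    simp only [this, intervalIntegral.integral_const_mul]
    simp
  · rw [intervalIntegral.integral_mul_deriv_eq_deriv_mul_of_hasDerivWithinAt
      (u' := fun s => -Real.sin (w * (c - s)) * (-w))
      (fun x _ => (hlin x).cos.hasDerivWithinAt) hf
      (Continuous.intervalIntegrable (by fun_prop) _ _) hf'.intervalIntegrable]
    have : ∀ s, -Real.sin (w * (c - s)) * (-w) * f s = w * (Real.sin (w * (c - s)) * f s) :=
      fun s => by ring
    simp only [this, intervalIntegral.integral_const_mul]
    simp

/-- under the non-resonance condition, for continuously differentiable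
`f` on `[a,b]` and `t₀ ∈ [a,b]`, the solution formula satisfies the representation
`y_ε(t₀) = f(t₀)/k
  + (cos(√(k/ε)(t₀-a)) / sin(√(k/ε)(b-a))) ∫_a^b sin(√(k/ε)(b-s)) f'(s)/k ds
  - ∫_a^{t₀} cos(√(k/ε)(t₀-s)) f'(s)/k ds`. -/
theorem stmt_7 (a b k ε t₀ : ℝ) (f f' : ℝ → ℝ) (hab : a < b) (hk : 0 < k) (hε : 0 < ε)
    (hres : Real.sin (Real.sqrt (k / ε) * (b - a)) ≠ 0)
    (hf : ∀ t ∈ Icc a b, HasDerivWithinAt f (f' t) (Icc a b) t)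
    (hf' : ContinuousOn f' (Icc a b)) (ht₀ : t₀ ∈ Icc a b) :
    yFormula a b k ε f t₀ =
      f t₀ / k +
        (Real.cos (Real.sqrt (k / ε) * (t₀ - a)) /
            Real.sin (Real.sqrt (k / ε) * (b - a))) *
          (∫ s in a..b, Real.sin (Real.sqrt (k / ε) * (b - s)) * (f' s / k)) -
        ∫ s in a..t₀, Real.cos (Real.sqrt (k / ε) * (t₀ - s)) * (f' s / k) := by
  have hsub : Icc a t₀ ⊆ Icc a b := Icc_subset_Icc_right ht₀.2
  have h1 := (aux_parts (Real.sqrt (k / ε)) a b f f' hab.le hf hf').1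
  have h2 := (aux_parts (Real.sqrt (k / ε)) a t₀ f f' ht₀.1
    (fun t ht => (hf t (hsub ht)).mono hsub) (hf'.mono hsub)).2
  have hw : 0 < Real.sqrt (k / ε) := Real.sqrt_pos.mpr (div_pos hk hε)
  have hw2 : k = ε * Real.sqrt (k / ε) ^ 2 := by
    rw [Real.sq_sqrt (div_pos hk hε).le]; field_simp
  unfold yFormula
  simp only [← mul_div_assoc, intervalIntegral.integral_div]
  rw [h1, h2]
  generalize Real.sqrt (k / ε) = w at *
  generalize (∫ s in a..b, Real.cos (w * (b - s)) * f s) = I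
  generalize (∫ s in a..t₀, Real.sin (w * (t₀ - s)) * f s) = J
  subst hw2
  field_simp
  ring
end

section
/- (Main theorem) Let $a<b$, $k>0$, $0<\lambda\le\pi/2$, and let $f:[a,b]\to\mathbb{R}$ be three times continuously differentiable. Then there exists a constant $C>0$ (depending only on $a,b,k,\lambda,f$) such that for every $n\in\mathbb{N}$ and every $\epsilon_n\in J_n=[\,k((b-a)/((n+1)\pi-\lambda))^2,\; k((b-a)/(n\pi+\lambda))^2\,]$, the unique solution $y_{\epsilon_n}$ of the Neumann problem $\epsilon_n y''+ky=f(t)$, $y'(a)=y'(b)=0$ satisfies $\sup_{t\in[a,b]}\left|y_{\epsilon_n}(t)-\frac{f(t)}{k}\right|\le C\sqrt{\epsilon_n}$; in particular, for any choice $\epsilon_n\in J_n$ the solutions $y_{\epsilon_n}$ converge uniformly on $[a,b]$ to the solution $u(t)=f(t)/k$ of the reduced problem $ky=f(t)$ as $n\to\infty$. -/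
open Real Set

/-- `y` (with first and second derivatives `y'`, `y''` on `[a,b]`) is a twice
continuously differentiable solution of the Neumann problem
`ε y'' + k y = f(t)` on `[a,b]`, `y'(a) = y'(b) = 0`. -/
def IsNeumannSolution (a b k ε : ℝ) (f y y' y'' : ℝ → ℝ) : Prop :=
  (∀ t ∈ Icc a b, HasDerivWithinAt y (y' t) (Icc a b) t) ∧
  (∀ t ∈ Icc a b, HasDerivWithinAt y' (y'' t) (Icc a b) t) ∧
  ContinuousOn y'' (Icc a b) ∧
  (∀ t ∈ Icc a b, ε * y'' t + k * y t = f t) ∧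
  y' a = 0 ∧ y' b = 0

theorem aux_sin (lam z : ℝ) (n : ℕ) (hlam : 0 < lam) (hlam' : lam ≤ π / 2)
    (h1 : n * π + lam ≤ z) (h2 : z ≤ (n + 1) * π - lam) : Real.sin lam ≤ |Real.sin z| := by
  have e : |Real.sin z| = |Real.sin (z - n * π)| := by
    rw [Real.sin_sub_nat_mul_pi, abs_mul, abs_pow, abs_neg, abs_one, one_pow, one_mul]
  rw [e]
  refine le_trans ?_ (le_abs_self _)
  have hpi := Real.pi_pos
  rcases le_total (z - n * π) (π / 2) with h | h
  · exact Real.sin_le_sin_of_le_of_le_pi_div_two (by linarith) h (by linarith)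
  · rw [← Real.sin_pi_sub (z - n * π)]
    exact Real.sin_le_sin_of_le_of_le_pi_div_two (by linarith) (by linarith) (by linarith)

theorem aux_flux (a b w c M : ℝ) (u u' u'' g : ℝ → ℝ)
    (hu : ∀ t ∈ Icc a b, HasDerivWithinAt u (u' t) (Icc a b) t)
    (hu' : ∀ t ∈ Icc a b, HasDerivWithinAt u' (u'' t) (Icc a b) t)
    (hode : ∀ t ∈ Icc a b, u'' t + w ^ 2 * u t = g t)
    (hg : ∀ t ∈ Icc a b, |g t| ≤ M) (s t : ℝ) (hs : s ∈ Icc a b) (ht : t ∈ Icc a b) :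
    |(u' t * Real.cos (w * (t - c)) + w * u t * Real.sin (w * (t - c)))
      - (u' s * Real.cos (w * (s - c)) + w * u s * Real.sin (w * (s - c)))| ≤ M * |t - s| := by
  have hd : ∀ x ∈ Icc a b, HasDerivWithinAt
      (fun x => u' x * Real.cos (w * (x - c)) + w * u x * Real.sin (w * (x - c)))
      (g x * Real.cos (w * (x - c))) (Icc a b) x := by
    intro x hx
    have hl : HasDerivWithinAt (fun x => w * (x - c)) (w * 1) (Icc a b) x :=
      ((hasDerivWithinAt_id x _).sub_const c).const_mul w
    have := ((hu' x hx).mul hl.cos).add (((hu x hx).const_mul w).mul hl.sin)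
    refine this.congr_deriv ?_
    rw [← hode x hx]
    ring
  have := (convex_Icc a b).norm_image_sub_le_of_norm_hasDerivWithin_le (C := M) hd
    (fun x hx => by
      rw [Real.norm_eq_abs, abs_mul]
      calc |g x| * |Real.cos (w * (x - c))| ≤ |g x| * 1 := by
            gcongr
            exact Real.abs_cos_le_one _
        _ ≤ M := by rw [mul_one]; exact hg x hx) hs ht
  simpa [Real.norm_eq_abs] using this

theorem aux_bound (a b w M N : ℝ) (u u' u'' g : ℝ → ℝ)
    (hu : ∀ t ∈ Icc a b, HasDerivWithinAt u (u' t) (Icc a b) t)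
    (hu' : ∀ t ∈ Icc a b, HasDerivWithinAt u' (u'' t) (Icc a b) t)
    (hode : ∀ t ∈ Icc a b, u'' t + w ^ 2 * u t = g t)
    (hg : ∀ t ∈ Icc a b, |g t| ≤ M) (ha : |u' a| ≤ N) (hb : |u' b| ≤ N)
    (t : ℝ) (ht : t ∈ Icc a b) :
    |w * u t * Real.sin (w * (b - a))| ≤ 2 * N + M * (b - a) := by
  have hab : a ≤ b := ht.1.trans ht.2
  have h1 := aux_flux a b w a M u u' u'' g hu hu' hode hg a t (left_mem_Icc.2 hab) ht
  have h2 := aux_flux a b w b M u u' u'' g hu hu' hode hg b t (right_mem_Icc.2 hab) ht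
  simp only [sub_self, mul_zero, Real.cos_zero, Real.sin_zero, mul_one, add_zero] at h1 h2
  rw [abs_of_nonneg (sub_nonneg.2 ht.1)] at h1
  rw [abs_of_nonpos (sub_nonpos.2 ht.2)] at h2
  set P := u' t * Real.cos (w * (t - a)) + w * u t * Real.sin (w * (t - a)) with hP
  set Q := u' t * Real.cos (w * (t - b)) + w * u t * Real.sin (w * (t - b)) with hQ
  have hs : w * (b - a) = w * (t - a) - w * (t - b) := by ring
  have e : w * u t * Real.sin (w * (b - a))
      = P * Real.cos (w * (t - b)) - Q * Real.cos (w * (t - a)) := by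
    rw [hs, Real.sin_sub, hP, hQ]
    ring
  have hPb : |P| ≤ N + M * (t - a) := by
    have := abs_sub_abs_le_abs_sub P (u' a)
    linarith
  have hQb : |Q| ≤ N + M * (b - t) := by
    have := abs_sub_abs_le_abs_sub Q (u' b)
    linarith
  rw [e]
  calc _ ≤ |P * Real.cos (w * (t - b))| + |Q * Real.cos (w * (t - a))| := abs_sub _ _
    _ = |P| * |Real.cos (w * (t - b))| + |Q| * |Real.cos (w * (t - a))| := by
        rw [abs_mul, abs_mul]
    _ ≤ |P| * 1 + |Q| * 1 := by
        gcongr <;> exact Real.abs_cos_le_one _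
    _ ≤ _ := by linarith

/-- Main theorem: there is a constant `C > 0` such that for every `n` and
every `ε ∈ Jₙ`, the solution `y_ε` of the Neumann problem `ε y'' + k y = f(t)`,
`y'(a) = y'(b) = 0` satisfies `sup_{t ∈ [a,b]} |y_ε(t) - f(t)/k| ≤ C √ε`; in particular,
for any choice `εₙ ∈ Jₙ` the solutions `y_{εₙ}` converge uniformly on `[a,b]` to the
solution `u(t) = f(t)/k` of the reduced problem `k y = f(t)` as `n → ∞`. -/
theorem stmt_12 (a b k lam : ℝ) (f f' f'' f''' : ℝ → ℝ)
    (hab : a < b) (hk : 0 < k) (hlam : 0 < lam) (hlam' : lam ≤ π / 2)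
    (hf : ∀ t ∈ Icc a b, HasDerivWithinAt f (f' t) (Icc a b) t)
    (hf' : ∀ t ∈ Icc a b, HasDerivWithinAt f' (f'' t) (Icc a b) t)
    (hf'' : ∀ t ∈ Icc a b, HasDerivWithinAt f'' (f''' t) (Icc a b) t)
    (hf''' : ContinuousOn f''' (Icc a b)) :
    (∃ C > 0, ∀ (n : ℕ) (ε : ℝ),
      ε ∈ Icc (k * ((b - a) / ((n + 1) * π - lam)) ^ 2)
        (k * ((b - a) / (n * π + lam)) ^ 2) →
      ∀ y y' y'' : ℝ → ℝ, IsNeumannSolution a b k ε f y y' y'' →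
        ∀ t ∈ Icc a b, |y t - f t / k| ≤ C * Real.sqrt ε) ∧
    (∀ (ε : ℕ → ℝ) (y : ℕ → ℝ → ℝ) (y' y'' : ℕ → ℝ → ℝ),
      (∀ n : ℕ, ε n ∈ Icc (k * ((b - a) / ((n + 1) * π - lam)) ^ 2)
        (k * ((b - a) / (n * π + lam)) ^ 2)) →
      (∀ n : ℕ, IsNeumannSolution a b k (ε n) f (y n) (y' n) (y'' n)) →
      TendstoUniformlyOn (fun n t => y n t) (fun t => f t / k) Filter.atTop (Icc a b)) := by
  have hL : 0 < b - a := sub_pos.2 hab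
  have hpi := Real.pi_pos
  have hsl : 0 < Real.sin lam := Real.sin_pos_of_pos_of_lt_pi hlam (by linarith)
  have hsk : 0 < Real.sqrt k := Real.sqrt_pos.2 hk
  have hkey : ∃ C > 0, ∀ (n : ℕ) (ε : ℝ),
      ε ∈ Icc (k * ((b - a) / ((n + 1) * π - lam)) ^ 2)
        (k * ((b - a) / (n * π + lam)) ^ 2) →
      ∀ y y' y'' : ℝ → ℝ, IsNeumannSolution a b k ε f y y' y'' →
        ∀ t ∈ Icc a b, |y t - f t / k| ≤ C * Real.sqrt ε := by
    have hcont : ContinuousOn f'' (Icc a b) := fun t ht => (hf'' t ht).continuousWithinAt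
    obtain ⟨M, hM⟩ := isCompact_Icc.exists_bound_of_continuousOn hcont
    have hM0 : 0 ≤ M := (norm_nonneg _).trans (hM a (left_mem_Icc.2 hab.le))
    set N := (|f' a| + |f' b|) / k with hN
    have hN0 : 0 ≤ N := by positivity
    set K := 2 * N + M / k * (b - a) + 1 with hK
    have hK0 : 0 < K := by positivity
    refine ⟨K / (Real.sin lam * Real.sqrt k), by positivity, ?_⟩
    rintro n ε ⟨h1, h2⟩ y y' y'' ⟨hy, hy', -, hode, hya, hyb⟩ t ht
    have hn : (0 : ℝ) ≤ n := Nat.cast_nonneg n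
    have hA : 0 < (n + 1) * π - lam := by nlinarith
    have hB : 0 < n * π + lam := by positivity
    have hε : 0 < ε := lt_of_lt_of_le (by positivity) h1
    set w := Real.sqrt (k / ε) with hw
    have hw0 : 0 < w := Real.sqrt_pos.2 (by positivity)
    have hw2 : w ^ 2 = k / ε := Real.sq_sqrt (by positivity)
    have hwL : (w * (b - a)) ^ 2 = k * (b - a) ^ 2 / ε := by rw [mul_pow, hw2]; ring
    have r1 : n * π + lam ≤ w * (b - a) := by
      refine le_of_sq_le_sq ?_ (by positivity)
      rw [hwL, le_div_iff₀ hε]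
      rw [div_pow, ← mul_div_assoc, le_div_iff₀ (by positivity)] at h2
      linarith
    have r2 : w * (b - a) ≤ (n + 1) * π - lam := by
      refine le_of_sq_le_sq ?_ hA.le
      rw [hwL, div_le_iff₀ hε]
      rw [div_pow, ← mul_div_assoc, div_le_iff₀ (by positivity)] at h1
      linarith
    have hsin := aux_sin lam _ n hlam hlam' r1 r2
    have hb := aux_bound a b w (M / k) N (fun t => y t - f t / k) (fun t => y' t - f' t / k)
      (fun t => y'' t - f'' t / k) (fun t => - f'' t / k)
      (fun t ht => (hy t ht).sub ((hf t ht).div_const k))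
      (fun t ht => (hy' t ht).sub ((hf' t ht).div_const k))
      (fun t ht => by
        have := hode t ht
        simp only [hw2]
        rw [← this]
        field_simp
        ring)
      (fun t ht => by
        rw [abs_div, abs_neg, abs_of_pos hk]
        have := hM t ht
        rw [Real.norm_eq_abs] at this
        gcongr)
      (by
        rw [hya, zero_sub, abs_neg, abs_div, abs_of_pos hk, hN]
        gcongr
        linarith [abs_nonneg (f' b)])
      (by
        rw [hyb, zero_sub, abs_neg, abs_div, abs_of_pos hk, hN]
        gcongr
        linarith [abs_nonneg (f' a)]) t ht
    rw [abs_mul, abs_mul, abs_of_pos hw0] at hb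
    have hb2 : w * |y t - f t / k| * Real.sin lam ≤ K :=
      (mul_le_mul_of_nonneg_left hsin (by positivity)).trans (by linarith)
    have hse : 0 < Real.sqrt ε := Real.sqrt_pos.2 hε
    rw [hw, Real.sqrt_div hk.le] at hb2
    rw [div_mul_eq_mul_div, le_div_iff₀ (by positivity)]
    calc _ = (√k / √ε * |y t - f t / k| * Real.sin lam) * √ε := by field_simp
      _ ≤ K * √ε := by gcongr
  refine ⟨hkey, ?_⟩
  obtain ⟨C, hC, hkey⟩ := hkey
  intro ε y y' y'' hε hy
  have hlim : Filter.Tendsto (fun n : ℕ => C * Real.sqrt (ε n)) Filter.atTop (nhds 0) := by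
    have h1 : Filter.Tendsto (fun n : ℕ => (n : ℝ) * π + lam) Filter.atTop Filter.atTop :=
      Filter.tendsto_atTop_add_const_right _ _
        (tendsto_natCast_atTop_atTop.atTop_mul_const hpi)
    have h2 : Filter.Tendsto (fun n : ℕ => k * ((b - a) / ((n : ℝ) * π + lam)) ^ 2)
        Filter.atTop (nhds 0) := by
      simpa using ((h1.const_div_atTop (b - a)).pow 2).const_mul k
    have h3 : Filter.Tendsto ε Filter.atTop (nhds 0) :=
      squeeze_zero (fun n => le_trans (by positivity) (hε n).1) (fun n => (hε n).2) h2
    simpa using (h3.sqrt).const_mul C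
  rw [Metric.tendstoUniformlyOn_iff]
  intro δ hδ
  filter_upwards [hlim.eventually (gt_mem_nhds hδ)] with n hn t ht
  rw [dist_comm, Real.dist_eq]
  exact (hkey n (ε n) (hε n) _ _ _ (hy n) t ht).trans_lt hn
end
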